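/- Let P, Q, q ∈ ℂ with P ≠ 0, Q ≠ 0, q ≠ 0, and let s ∈ ℂ satisfy s² = (P(1−q) + Q(1+q))² − 4qQ². Define U₀ = (s − (P(1−q) + Q(1+q)))/(2qQ) and V₀ = (s − (P(1+q) + Q(1−q)))/(2Pq). Then: (i) 1 + U₀ + V₀ + q U₀ V₀ = 0, i.e. (U₀,V₀) lies on the mirror curve C_q; (ii) Pq V₀² + (P(1+q) + Q(1−q)) V₀ + P = 0; (iii) Qq U₀² + (Q(1+q) + P(1−q)) U₀ + Q = 0. (The two choices of square root s give the two ramification points P₀, P₁ of X = U^Q V^P on C_q.) -/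

import Mathlib

theorem explicit_ramification_points_of_mirror_curve
    (P Q q s : ℂ) (hP : P ≠ 0) (hQ : Q ≠ 0) (hq : q ≠ 0)
    (hs : s ^ 2 = (P * (1 - q) + Q * (1 + q)) ^ 2 - 4 * q * Q ^ 2) :
    ∀ U₀ V₀ : ℂ,
      U₀ = (s - (P * (1 - q) + Q * (1 + q))) / (2 * q * Q) →
      V₀ = (s - (P * (1 + q) + Q * (1 - q))) / (2 * P * q) →
      1 + U₀ + V₀ + q * U₀ * V₀ = 0 ∧
      P * q * V₀ ^ 2 + (P * (1 + q) + Q * (1 - q)) * V₀ + P = 0 ∧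
      Q * q * U₀ ^ 2 + (Q * (1 + q) + P * (1 - q)) * U₀ + Q = 0 := by
  intro U₀ V₀ hU hV
  rw [eq_div_iff (by simp [hq, hQ])] at hU
  rw [eq_div_iff (by simp [hP, hq])] at hV
  refine ⟨?_, ?_, ?_⟩
  · have h : 4 * P * Q * q ≠ 0 := by simp [hP, hQ, hq]
    refine (mul_eq_zero.mp ?_).resolve_left h
    linear_combination (2 * P + 2 * P * q * V₀) * hU +
      (2 * Q + (s - (P * (1 - q) + Q * (1 + q)))) * hV + hs
  · have h : 4 * P * q ≠ 0 := by simp [hP, hq]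
    refine (mul_eq_zero.mp ?_).resolve_left h
    linear_combination (2 * P * q * V₀ + (P * (1 + q) + Q * (1 - q)) + s) * hV + hs
  · have h : 4 * Q * q ≠ 0 := by simp [hQ, hq]
    refine (mul_eq_zero.mp ?_).resolve_left h
    linear_combination (2 * q * Q * U₀ + (P * (1 - q) + Q * (1 + q)) + s) * hU + hs
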